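/- Let T = (Q, Σ, δ) be a reversible but not bi-reversible G-automaton and let Γ ⊆ Σ be the set of letters that, viewed as states of the dual automaton ∂T, belong to a non-bi-reversible connected component of ∂T. Then every ω-word ξ ∈ Σ^ω that contains at least one letter from Γ infinitely often has infinite orbit: |Q*∘ξ| = ∞. -/

import Mathlib

/- Common framework for automaton semigroups acting on finite and infinite words.

An S-automaton over states `Q` and alphabet `A` is given by a partial deterministic
transition function `δ : Q → A → Option (A × Q)` (with `δ q a = some (b, p)` encoding
the transition `q –a/b→ p`). -/

namespace AutOrbit

variable {Q A : Type*}

/-- The partial action `q∘` of a single state on a finite word. -/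
def stateAct (δ : Q → A → Option (A × Q)) : Q → List A → Option (List A)
  | _, [] => some []
  | q, a :: u => (δ q a).bind fun bp => (stateAct δ bp.2 u).map fun v => bp.1 :: v

/-- The partial action `𝐪∘` of a state sequence `𝐪 = q_n … q_1` (written left-to-right,
head of the list is `q_n`; the rightmost state `q_1` is applied first). -/
def seqAct (δ : Q → A → Option (A × Q)) (l : List Q) (u : List A) : Option (List A) :=
  l.foldr (fun q acc => acc.bind (stateAct δ q)) (some u)

/-- The length-`n` prefix of an ω-word. -/
def pre (ξ : ℕ → A) (n : ℕ) : List A := List.ofFn fun i : Fin n => ξ i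

/-- The `L`-orbit `L∘u` of a finite word `u`. -/
def orbit (δ : Q → A → Option (A × Q)) (L : Set (List Q)) (u : List A) : Set (List A) :=
  {v | ∃ l ∈ L, seqAct δ l u = some v}

/-- The `L`-orbit `L∘ξ` of an ω-word `ξ`: all ω-words `η` such that some `𝐪 ∈ L` is
defined on `ξ` with `𝐪∘ξ = η` (i.e. `𝐪∘` maps every prefix of `ξ` to the
corresponding prefix of `η`). -/
def omegaOrbit (δ : Q → A → Option (A × Q)) (L : Set (List Q)) (ξ : ℕ → A) :
    Set (ℕ → A) :=
  {η | ∃ l ∈ L, ∀ n, seqAct δ l (pre ξ n) = some (pre η n)}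

/-- The set of partial maps `L∘ = {𝐪∘ ∣ 𝐪 ∈ L}`. -/
def mapsOf (δ : Q → A → Option (A × Q)) (L : Set (List Q)) :
    Set (List A → Option (List A)) :=
  {f | ∃ l ∈ L, f = seqAct δ l}

/-- `L ⊆ F*` is suffix-closed over `F`: every `𝐪 ∈ L` factorizes into factors from `F`
such that every suffix (as a word over the alphabet `F`) of the factorization is
again in `L`. -/
def SuffixClosedOver (F L : Set (List Q)) : Prop :=
  ∀ l ∈ L, ∃ fs : List (List Q),
    (∀ f ∈ fs, f ∈ F) ∧ fs.flatten = l ∧ ∀ i, (fs.drop i).flatten ∈ L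

/-- `L` is finitely suffix-closed: suffix-closed over some finite nonempty `F ⊆ Q*`. -/
def FinitelySuffixClosed (L : Set (List Q)) : Prop :=
  ∃ F : Set (List Q), F.Finite ∧ F.Nonempty ∧ SuffixClosedOver F L

/-- `u` has infinite potential w.r.t. `δ` and `L`: the orbit sizes `|L∘ux|` are unbounded. -/
def InfinitePotential (δ : Q → A → Option (A × Q)) (L : Set (List Q)) (u : List A) : Prop :=
  ∀ C : ℕ, ∃ x : List A, C < (orbit δ L (u ++ x)).ncard

/-- The `i`-th power `𝐪^i` of a state sequence. -/
def listPow (l : List Q) (i : ℕ) : List Q := (List.replicate i l).flatten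

/-- `𝐪∘` has torsion: two distinct positive powers induce the same partial map. -/
def HasTorsion (δ : Q → A → Option (A × Q)) (l : List Q) : Prop :=
  ∃ i j : ℕ, 1 ≤ i ∧ 1 ≤ j ∧ i ≠ j ∧ seqAct δ (listPow l i) = seqAct δ (listPow l j)

/-- The automaton is complete: `δ` is total. -/
def Complete (δ : Q → A → Option (A × Q)) : Prop := ∀ q a, (δ q a).isSome

/-- The automaton is invertible: for every state, the letter-to-output-letter map is a
bijection of the alphabet (each output letter is produced by exactly one input letter). -/
def Invertible (δ : Q → A → Option (A × Q)) : Prop :=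
  ∀ q b, ∃! a, ∃ p, δ q a = some (b, p)

/-- A G-automaton: a complete invertible S-automaton. -/
def GAutomaton (δ : Q → A → Option (A × Q)) : Prop := Complete δ ∧ Invertible δ

/-- Reversibility: for every input letter `a` and target state `p` there is at most one
transition `q –a/b→ p`. -/
def Reversible (δ : Q → A → Option (A × Q)) : Prop :=
  ∀ a p q₁ b₁ q₂ b₂, δ q₁ a = some (b₁, p) → δ q₂ a = some (b₂, p) → q₁ = q₂

/-- Reversibility of the inverse automaton: for every output letter `b` and target
state `p` there is at most one transition `q –a/b→ p`. -/
def InvReversible (δ : Q → A → Option (A × Q)) : Prop :=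
  ∀ b p q₁ a₁ q₂ a₂, δ q₁ a₁ = some (b, p) → δ q₂ a₂ = some (b, p) → q₁ = q₂ ∧ a₁ = a₂

/-- Bi-reversibility: the automaton and its inverse automaton are both reversible. -/
def BiReversible (δ : Q → A → Option (A × Q)) : Prop := Reversible δ ∧ InvReversible δ

/-- The dual automaton `∂T`: states are letters, letters are states; it has a transition
`a –q/p→ b` for every transition `q –a/b→ p` of `T`. -/
def dual (δ : Q → A → Option (A × Q)) : A → Q → Option (Q × A) :=
  fun a q => (δ q a).map fun bp => (bp.2, bp.1)

/-- Adjacency of states in the underlying undirected graph of the automaton. -/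
def Adj (δ : Q → A → Option (A × Q)) (q p : Q) : Prop :=
  (∃ a b, δ q a = some (b, p)) ∨ (∃ a b, δ p a = some (b, q))

/-- `P` is (the state set of) a connected component of the automaton. -/
def IsComponent (δ : Q → A → Option (A × Q)) (P : Set Q) : Prop :=
  ∃ q, P = {p | Relation.ReflTransGen (Adj δ) q p}

/-- The sub-automaton induced on `P` (with all transitions among states of `P`)
is reversible. -/
def SubReversible (δ : Q → A → Option (A × Q)) (P : Set Q) : Prop :=
  ∀ a : A, ∀ p ∈ P, ∀ q₁ b₁ q₂ b₂, q₁ ∈ P → q₂ ∈ P →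
    δ q₁ a = some (b₁, p) → δ q₂ a = some (b₂, p) → q₁ = q₂

/-- The inverse of the sub-automaton induced on `P` is reversible. -/
def SubInvReversible (δ : Q → A → Option (A × Q)) (P : Set Q) : Prop :=
  ∀ b : A, ∀ p ∈ P, ∀ q₁ a₁ q₂ a₂, q₁ ∈ P → q₂ ∈ P →
    δ q₁ a₁ = some (b, p) → δ q₂ a₂ = some (b, p) → q₁ = q₂ ∧ a₁ = a₂

/-- The sub-automaton induced on `P` is bi-reversible. -/
def SubBiReversible (δ : Q → A → Option (A × Q)) (P : Set Q) : Prop :=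
  SubReversible δ P ∧ SubInvReversible δ P

/-- For a complete automaton, the (total) action of a state on a finite word. -/
noncomputable def totAct (δ : Q → A → Option (A × Q)) (q : Q) (u : List A) : List A :=
  (stateAct δ q u).getD u

/-- The action of a state of the automaton (`Sum.inl`) or of its inverse automaton
(`Sum.inr`): for a G-automaton, `totAct δ q` is a bijection of `Σ*` and the inverse
state `q̄` acts as its inverse bijection. -/
noncomputable def gAct (δ : Q → A → Option (A × Q)) : Q ⊕ Q → List A → List A
  | Sum.inl q => totAct δ q
  | Sum.inr q => Function.invFun (totAct δ q)

/-- Action of a sequence over `Q ⊔ Q̄` (rightmost entry applied first). -/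
noncomputable def gSeqAct (δ : Q → A → Option (A × Q)) (l : List (Q ⊕ Q)) (u : List A) :
    List A :=
  l.foldr (fun s v => gAct δ s v) u

/-- The automaton group `G(T) = {𝐪∘ ∣ 𝐪 ∈ (Q ⊔ Q̄)⁺}` as a set of maps on `Σ*`. -/
def autGroup (δ : Q → A → Option (A × Q)) : Set (List A → List A) :=
  {f | ∃ l : List (Q ⊕ Q), l ≠ [] ∧ f = gSeqAct δ l}

/-- The ultimately periodic ω-word `u (a v)^ω`. -/
def ultPer (u : List A) (a : A) (v : List A) (n : ℕ) : A :=
  if h : n < u.length then u.get ⟨n, h⟩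
  else (a :: v).get ⟨(n - u.length) % (a :: v).length, Nat.mod_lt _ (by simp)⟩

/-- Run of a single state on a word, returning the output word and the final state. -/
def runState (δ : Q → A → Option (A × Q)) : Q → List A → Option (List A × Q)
  | q, [] => some ([], q)
  | q, a :: u => (δ q a).bind fun bp =>
      (runState δ bp.2 u).map fun vr => (bp.1 :: vr.1, vr.2)

/-- Run of a state sequence `𝐪` on a word `u`, returning the output word `𝐪∘u` and the
residual state sequence `𝐪·u` (the dual action). -/
def runSeq (δ : Q → A → Option (A × Q)) : List Q → List A → Option (List A × List Q)
  | [], u => some (u, [])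
  | q :: l, u => (runSeq δ l u).bind fun vr =>
      (runState δ q vr.1).map fun wp => (wp.1, wp.2 :: vr.2)

/-- Nodes of the `L`-orbital transducer over `F` of `u`: words reached from `u` along a
path of `F`-labeled edges whose reverse label (a word over `F`) lies in `L`. -/
def transNodes (δ : Q → A → Option (A × Q)) (F L : Set (List Q)) (u : List A) :
    Set (List A) :=
  {v | ∃ fs : List (List Q), (∀ f ∈ fs, f ∈ F) ∧ fs.flatten ∈ L ∧
        ∃ r, runSeq δ fs.flatten u = some (v, r)}

/-- Edges of the `L`-orbital transducer over `F` of `u`: an edge `v –𝐩/𝐨→ w` with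
`𝐩 ∈ F`, input label `𝐩`, output label `𝐨 = 𝐩·v`, lying on a path from `u` whose
reverse label is in `L`. -/
def transEdge (δ : Q → A → Option (A × Q)) (F L : Set (List Q)) (u : List A)
    (v : List A) (p o : List Q) (w : List A) : Prop :=
  p ∈ F ∧ ∃ fs : List (List Q), (∀ f ∈ fs, f ∈ F) ∧ (p :: fs).flatten ∈ L ∧
    (∃ r, runSeq δ fs.flatten u = some (v, r)) ∧ runSeq δ p v = some (w, o)

/-- Isomorphism of the `L`-orbital transducers over `F` of `u₁` and `u₂`: a bijection of
the node sets mapping `u₁` to `u₂` and preserving labeled edges in both directions. -/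
def TransducerIso (δ : Q → A → Option (A × Q)) (F L : Set (List Q)) (u₁ u₂ : List A) :
    Prop :=
  ∃ φ : List A → List A,
    Set.BijOn φ (transNodes δ F L u₁) (transNodes δ F L u₂) ∧ φ u₁ = u₂ ∧
    ∀ v ∈ transNodes δ F L u₁, ∀ w ∈ transNodes δ F L u₁, ∀ p o : List Q,
      (transEdge δ F L u₁ v p o w ↔ transEdge δ F L u₂ (φ v) p o (φ w))


/-- The states from which an edge with output label `p` leads into `V`, in the labelled graph
with an edge `x → act q x` of output label `lab q x` for every `q` and `x`. -/
noncomputable def pull {X : Type*} [Fintype X] (lab : Q → X → Q) (act : Q → X → X) (p : Q)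
    (V : Finset X) : Finset X :=
  open Classical in Finset.univ.filter fun x => ∃ q, lab q x = p ∧ act q x ∈ V

theorem mem_pull {X : Type*} [Fintype X] {lab : Q → X → Q} {act : Q → X → X} {p : Q}
    {V : Finset X} {x : X} : x ∈ pull lab act p V ↔ ∃ q, lab q x = p ∧ act q x ∈ V := by
  simp [pull]

/-- The full preimages of single states under words of output labels. -/
inductive Sync {X : Type*} [Fintype X] (lab : Q → X → Q) (act : Q → X → X) : Finset X → Prop
  | single (x : X) : Sync lab act {x}
  | pull (p : Q) (V : Finset X) : Sync lab act V → Sync lab act (pull lab act p V)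

theorem sum_card_pull {X : Type*} [Fintype X] [Fintype Q] {lab : Q → X → Q} {act : Q → X → X}
    (hlab : ∀ x, Function.Injective fun q => lab q x) (hact : ∀ q, Function.Injective (act q))
    (V : Finset X) : ∑ p, (pull lab act p V).card = Fintype.card Q * V.card := by
  classical
  have h1 : ∀ x, (∑ p, if ∃ q, lab q x = p ∧ act q x ∈ V then 1 else 0)
      = ∑ q, if act q x ∈ V then 1 else 0 := by
    intro x
    rw [← Finset.card_filter, ← Finset.card_filter,
      ← Finset.card_image_of_injective (Finset.univ.filter fun q => act q x ∈ V) (hlab x)]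
    congr 1
    ext p
    simp [and_comm]
  have h2 : ∀ q, (∑ x, if act q x ∈ V then 1 else 0) = V.card := by
    intro q
    rw [← Finset.card_filter, ← Finset.card_image_of_injective _ (hact q)]
    congr 1
    ext y
    simp only [Finset.mem_image, Finset.mem_filter, Finset.mem_univ, true_and]
    constructor
    · rintro ⟨x, hx, rfl⟩
      exact hx
    · intro hy
      obtain ⟨x, rfl⟩ := (Finite.injective_iff_surjective.1 (hact q)) y
      exact ⟨x, hy, rfl⟩
  simp only [pull, Finset.card_filter]
  rw [Finset.sum_comm]
  trans ∑ x, ∑ q, if act q x ∈ V then 1 else 0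
  · exact Finset.sum_congr rfl fun x _ => by convert h1 x
  · rw [Finset.sum_comm]
    simp [h2]

/-- Pulling back a `Sync` set of maximal size again gives a set of maximal size, because the
labelled graph has equal in- and out-degrees. -/
theorem card_pull_eq {X : Type*} [Fintype X] [Fintype Q] {lab : Q → X → Q} {act : Q → X → X}
    (hlab : ∀ x, Function.Injective fun q => lab q x) (hact : ∀ q, Function.Injective (act q))
    {V : Finset X} (hV : Sync lab act V) (hmax : ∀ W, Sync lab act W → W.card ≤ V.card) (p : Q) :
    (pull lab act p V).card = V.card := by
  have h : ∑ p, (pull lab act p V).card = ∑ _p : Q, V.card := by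
    rw [sum_card_pull hlab hact]
    simp
  exact (Finset.sum_eq_sum_iff_of_le fun p _ => hmax _ (hV.pull p V)).1 h p (Finset.mem_univ p)

theorem Sync.letter_eq {X : Type*} [Fintype X] {out : Q → A → A} {lab : Q → X → Q}
    {act : Q → X → X} {f : X → A} (hout : ∀ q, Function.Injective (out q))
    (hf : ∀ q x, f (act q x) = out (lab q x) (f x)) {V : Finset X} (hV : Sync lab act V) :
    ∀ x ∈ V, ∀ y ∈ V, f x = f y := by
  induction hV with
  | single x => simp
  | pull p V _ ih =>
    intro x hx y hy
    obtain ⟨q, rfl, hq⟩ := mem_pull.1 hx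
    obtain ⟨r, hr, hr'⟩ := mem_pull.1 hy
    apply hout (lab q x)
    rw [← hf, ← hr, ← hf]
    exact ih _ hq _ hr'

theorem pull_subset_pull {X : Type*} [Fintype X] {out : Q → A → A} {nxt : Q → A → Q}
    {lab lab' : Q → X → Q} {act : Q → X → X} {f : X → A} (hout : ∀ q, Function.Injective (out q))
    (hf : ∀ q x, f (act q x) = out (lab q x) (f x))
    (hlab' : ∀ q x, lab' q x = nxt (lab q x) (f x)) {V W : Finset X} (hVW : V ⊆ W) {p : Q} {b : A}
    (hb : ∀ x ∈ V, f x = out p b) : pull lab act p V ⊆ pull lab' act (nxt p b) W := by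
  intro x hx
  obtain ⟨q, rfl, hq⟩ := mem_pull.1 hx
  have : f x = b := hout (lab q x) (by rw [← hf, hb _ hq])
  exact mem_pull.2 ⟨q, by rw [hlab', this], hVW hq⟩

theorem Sync.exists_superset {X : Type*} [Fintype X] [Finite A] {out : Q → A → A}
    {nxt : Q → A → Q} {lab lab' : Q → X → Q} {act : Q → X → X} {f : X → A}
    (hout : ∀ q, Function.Injective (out q)) (hf : ∀ q x, f (act q x) = out (lab q x) (f x))
    (hlab' : ∀ q x, lab' q x = nxt (lab q x) (f x)) {V : Finset X} (hV : Sync lab act V) :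
    ∃ W, Sync lab' act W ∧ V ⊆ W := by
  induction hV with
  | single x => exact ⟨{x}, .single x, subset_rfl⟩
  | pull p V hV ih =>
    obtain ⟨W, hW, hVW⟩ := ih
    rcases V.eq_empty_or_nonempty with rfl | ⟨x, hx⟩
    · exact ⟨W, hW, fun y hy => by simp [mem_pull] at hy⟩
    · obtain ⟨b, hb⟩ := (Finite.injective_iff_surjective.1 (hout p)) (f x)
      exact ⟨_, hW.pull (nxt p b) W, pull_subset_pull hout hf hlab' hVW
        fun y hy => by rw [hb, hV.letter_eq hout hf y hy x hx]⟩

/-- If two transitions into letters of the component of the maximal `Sync` sets collide, then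
passing to the next level of labels at least doubles the maximal size of `Sync` sets. -/
theorem exists_sync_two_mul_le {X : Type*} [Fintype X] [Fintype Q] [Finite A] {out : Q → A → A}
    {nxt : Q → A → Q} {lab lab' : Q → X → Q} {act : Q → X → X} {f : X → A}
    (hout : ∀ q, Function.Injective (out q)) (hf : ∀ q x, f (act q x) = out (lab q x) (f x))
    (hlab' : ∀ q x, lab' q x = nxt (lab q x) (f x))
    (hlab : ∀ x, Function.Injective fun q => lab q x) (hact : ∀ q, Function.Injective (act q))
    {c : A} (hc : ∀ x, Relation.ReflTransGen
      (fun a b => (∃ q, out q a = b) ∨ ∃ q, out q b = a) (f x) c)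
    {q₁ q₂ : Q} {a₁ a₂ : A} (ha : a₁ ≠ a₂) (h₁ : out q₁ a₁ = c) (h₂ : out q₂ a₂ = c)
    (hn : nxt q₁ a₁ = nxt q₂ a₂) {V : Finset X} (hV : Sync lab act V) (hne : V.Nonempty) :
    ∃ W, Sync lab' act W ∧ 2 * V.card ≤ W.card := by
  classical
  obtain ⟨V₀, hV₀, hmax₀⟩ := Finset.exists_max_image (Finset.univ.filter fun V => Sync lab act V)
    Finset.card ⟨V, by simpa using hV⟩
  simp only [Finset.mem_filter, Finset.mem_univ, true_and] at hV₀ hmax₀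
  have hpos : 0 < V₀.card := (Finset.card_pos.2 hne).trans_le (hmax₀ _ hV)
  let C : Set A := {d | ∃ W, Sync lab act W ∧ W.card = V₀.card ∧ ∀ x ∈ W, f x = d}
  have hCinv : ∀ q d, out q d ∈ C → d ∈ C := by
    rintro q d ⟨W, hW, hWc, hWd⟩
    refine ⟨pull lab act q W, hW.pull q W, ?_, ?_⟩
    · rw [card_pull_eq hlab hact hW (fun U hU => by rw [hWc]; exact hmax₀ U hU), hWc]
    · intro x hx
      obtain ⟨r, rfl, hr⟩ := mem_pull.1 hx
      exact hout (lab r x) (by rw [← hf, hWd _ hr])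
  have hCfwd : ∀ q d, d ∈ C → out q d ∈ C := by
    intro q d hd
    have hbij : Function.Bijective (out q) :=
      ⟨hout q, Finite.injective_iff_surjective.1 (hout q)⟩
    have hsub : out q ⁻¹' C ⊆ C := fun d => hCinv q d
    have heq : out q ⁻¹' C = C := by
      apply Set.eq_of_subset_of_ncard_le hsub _ (Set.toFinite _)
      rw [Set.ncard_preimage_of_injective_subset_range (hout q) (by simp [hbij.2.range_eq])]
    rw [← heq] at hd
    exact hd
  have hcC : c ∈ C := by
    obtain ⟨x, hx⟩ := Finset.card_pos.1 hpos
    have hxC : f x ∈ C := ⟨V₀, hV₀, rfl, fun y hy => hV₀.letter_eq hout hf y hy x hx⟩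
    have hconn := hc x
    clear hc h₁ h₂
    induction hconn with
    | refl => exact hxC
    | tail _ h ih =>
      rcases h with ⟨q, rfl⟩ | ⟨q, rfl⟩
      · exact hCfwd q _ ih
      · exact hCinv q _ ih
  obtain ⟨U, hU, hUc, hUf⟩ := hcC
  have hUmax : ∀ W, Sync lab act W → W.card ≤ U.card := fun W hW => by
    rw [hUc]; exact hmax₀ W hW
  obtain ⟨W, hW, hUW⟩ := hU.exists_superset hout hf hlab'
  refine ⟨_, hW.pull (nxt q₁ a₁) W, ?_⟩
  have s₁ : pull lab act q₁ U ⊆ pull lab' act (nxt q₁ a₁) W :=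
    pull_subset_pull hout hf hlab' hUW fun x hx => by rw [hUf x hx, h₁]
  have s₂ : pull lab act q₂ U ⊆ pull lab' act (nxt q₁ a₁) W := by
    rw [hn]
    exact pull_subset_pull hout hf hlab' hUW fun x hx => by rw [hUf x hx, h₂]
  have hdisj : Disjoint (pull lab act q₁ U) (pull lab act q₂ U) := by
    rw [Finset.disjoint_left]
    intro x hx hx'
    obtain ⟨r, rfl, hr⟩ := mem_pull.1 hx
    obtain ⟨t, rfl, ht⟩ := mem_pull.1 hx'
    have e₁ : f x = a₁ := hout (lab r x) (by rw [← hf, hUf _ hr, h₁])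
    have e₂ : f x = a₂ := hout (lab t x) (by rw [← hf, hUf _ ht, h₂])
    exact ha (e₁.symm.trans e₂)
  have := Finset.card_le_card (Finset.union_subset s₁ s₂)
  rw [Finset.card_union_of_disjoint hdisj, card_pull_eq hlab hact hU hUmax,
    card_pull_eq hlab hact hU hUmax] at this
  have := hmax₀ V hV
  omega

/-- The state reached by a complete automaton after reading the first `n` letters of `η`. -/
def omegaState (nxt : Q → A → Q) (q : Q) (η : ℕ → A) : ℕ → Q
  | 0 => q
  | n + 1 => nxt (omegaState nxt q η n) (η n)

/-- The action of a state of a complete automaton on ω-words. -/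
def omegaAct (out : Q → A → A) (nxt : Q → A → Q) (q : Q) (η : ℕ → A) (n : ℕ) : A :=
  out (omegaState nxt q η n) (η n)

theorem omegaState_succ' (nxt : Q → A → Q) (q : Q) (η : ℕ → A) (n : ℕ) :
    omegaState nxt q η (n + 1) = omegaState nxt (nxt q (η 0)) (fun k => η (k + 1)) n := by
  induction n with
  | zero => rfl
  | succ n ih => rw [omegaState, ih, omegaState]

theorem omegaState_injective {nxt : Q → A → Q}
    (hnxt : ∀ a, Function.Injective fun q => nxt q a) (η : ℕ → A) (n : ℕ) :
    Function.Injective fun q => omegaState nxt q η n := by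
  induction n with
  | zero => exact fun _ _ h => h
  | succ n ih => exact (hnxt (η n)).comp ih

theorem omegaAct_injective {out : Q → A → A} {nxt : Q → A → Q}
    (hout : ∀ q, Function.Injective (out q)) (q : Q) :
    Function.Injective (omegaAct out nxt q) := by
  intro η θ h
  have key : ∀ n, omegaState nxt q η n = omegaState nxt q θ n → η n = θ n := by
    intro n hn
    have := congrFun h n
    simp only [omegaAct, hn] at this
    exact hout _ this
  have hst : ∀ n, omegaState nxt q η n = omegaState nxt q θ n := by
    intro n
    induction n with
    | zero => rfl
    | succ n ih => simp only [omegaState, ih, key n ih]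
  exact funext fun n => key n (hst n)

theorem pre_succ (η : ℕ → A) (n : ℕ) :
    pre η (n + 1) = η 0 :: pre (fun k => η (k + 1)) n := by
  simp [pre, List.ofFn_succ]

theorem stateAct_pre {δ : Q → A → Option (A × Q)} {out : Q → A → A} {nxt : Q → A → Q}
    (hδ : ∀ q a, δ q a = some (out q a, nxt q a)) (q : Q) (η : ℕ → A) (n : ℕ) :
    stateAct δ q (pre η n) = some (pre (omegaAct out nxt q η) n) := by
  induction n generalizing q η with
  | zero => simp [pre, stateAct]
  | succ n ih =>
    rw [pre_succ, pre_succ, stateAct, hδ]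
    have h : (fun k => omegaAct out nxt q η (k + 1)) =
        omegaAct out nxt (nxt q (η 0)) fun k => η (k + 1) := by
      funext k
      simp only [omegaAct, omegaState_succ']
    simp [ih, h]
    rfl

theorem seqAct_pre {δ : Q → A → Option (A × Q)} {out : Q → A → A} {nxt : Q → A → Q}
    (hδ : ∀ q a, δ q a = some (out q a, nxt q a)) (l : List Q) (η : ℕ → A) (n : ℕ) :
    seqAct δ l (pre η n) = some (pre (l.foldr (omegaAct out nxt) η) n) := by
  induction l with
  | nil => rfl
  | cons q l ih =>
    change (seqAct δ l (pre η n)).bind (stateAct δ q) = _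
    rw [ih]
    exact stateAct_pre hδ q _ n

/-- Let `T` be a reversible but not bi-reversible G-automaton and let
`Γ ⊆ Σ` be the set of letters belonging (as states of the dual automaton `∂T`) to a
non-bi-reversible connected component of `∂T`. Then every ω-word containing a letter
from `Γ` infinitely often has an infinite orbit. -/
theorem infinite_orbit_of_infinitely_many_nonBireversible_letters {Q A : Type*}
    [Fintype Q] [Fintype A] [Nonempty A] (δ : Q → A → Option (A × Q))
    (hG : GAutomaton δ) (hRev : Reversible δ) (hnBi : ¬ BiReversible δ) (ξ : ℕ → A)
    (hinf : ∃ a : A, (∃ P : Set A, IsComponent (dual δ) P ∧ ¬ SubBiReversible (dual δ) P ∧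
      a ∈ P) ∧ {n : ℕ | ξ n = a}.Infinite) :
    (omegaOrbit δ (Set.univ : Set (List Q)) ξ).Infinite := by
  choose g hg using fun q a => Option.isSome_iff_exists.1 (hG.1 q a)
  obtain ⟨out, nxt, hδ⟩ : ∃ (out : Q → A → A) (nxt : Q → A → Q),
      ∀ q a, δ q a = some (out q a, nxt q a) := ⟨fun q a => (g q a).1, fun q a => (g q a).2, hg⟩
  have hout : ∀ q, Function.Injective (out q) := fun q a b h =>
    (hG.2 q (out q b)).unique ⟨_, by rw [hδ, h]⟩ ⟨_, hδ q b⟩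
  have hnxt : ∀ a, Function.Injective fun q => nxt q a := fun a q r h =>
    hRev a (nxt r a) q _ r _ (by rw [hδ]; exact congrArg (fun p => some (_, p)) h) (hδ r a)
  obtain ⟨a, ⟨P, ⟨a₀, rfl⟩, hP, haP⟩, ha⟩ := hinf
  have hAdj : ∀ b d, Adj (dual δ) b d ↔ (∃ q, out q b = d) ∨ ∃ q, out q d = b := by
    simp [Adj, dual, hδ]
  have hRel : Adj (dual δ) = fun b d => (∃ q, out q b = d) ∨ ∃ q, out q d = b := by
    funext b d
    exact propext (hAdj b d)
  have : Std.Symm (Adj (dual δ)) := ⟨fun _ _ h => Or.symm h⟩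
  have hsymm : ∀ {b d}, Relation.ReflTransGen (Adj (dual δ)) b d →
      Relation.ReflTransGen (Adj (dual δ)) d b := fun h => symm h
  obtain ⟨p, c, hc, a₁, q₁, a₂, q₂, h₁, h₂, hne⟩ : ∃ p c,
      Relation.ReflTransGen (Adj (dual δ)) a₀ c ∧
      ∃ a₁ q₁ a₂ q₂, δ q₁ a₁ = some (c, p) ∧ δ q₂ a₂ = some (c, p) ∧
        ¬ (a₁ = a₂ ∧ q₁ = q₂) := by
    by_contra! hcon
    refine hP ⟨?_, ?_⟩
    · intro q b _ b₁ r₁ b₂ r₂ _ _ e₁ e₂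
      simp only [dual, hδ, Option.map_some, Option.some.injEq, Prod.mk.injEq] at e₁ e₂
      exact hout q (e₁.2.trans e₂.2.symm)
    · intro p b hb b₁ r₁ b₂ r₂ _ _ e₁ e₂
      simp only [dual, hδ, Option.map_some, Option.some.injEq, Prod.mk.injEq] at e₁ e₂
      exact hcon p b hb b₁ r₁ b₂ r₂ (by rw [hδ, e₁.1, e₁.2]) (by rw [hδ, e₂.1, e₂.2])
  have ha₁₂ : a₁ ≠ a₂ := by
    rintro rfl
    exact hne ⟨rfl, hRev _ _ _ _ _ _ h₁ h₂⟩
  simp only [hδ, Option.some.injEq, Prod.mk.injEq] at h₁ h₂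
  intro hfin
  let O : Set (ℕ → A) := Set.range fun l : List Q => l.foldr (omegaAct out nxt) ξ
  have hO : O.Finite := hfin.subset <| by
    rintro _ ⟨l, rfl⟩
    exact ⟨l, trivial, fun n => seqAct_pre hδ l ξ n⟩
  have : Fintype O := hO.fintype
  let act : Q → O → O := fun q x => ⟨omegaAct out nxt q x.1, by
    obtain ⟨l, hl⟩ := x.2
    exact ⟨q :: l, by rw [← hl]; rfl⟩⟩
  let lab : ℕ → Q → O → Q := fun n q x => omegaState nxt q x.1 n
  have hact : ∀ q, Function.Injective (act q) := fun q x y h =>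
    Subtype.ext (omegaAct_injective hout q (congrArg Subtype.val h))
  have hf : ∀ n q (x : O), (act q x).1 n = out (lab n q x) (x.1 n) := fun _ _ _ => rfl
  have hlab' : ∀ n q (x : O), lab (n + 1) q x = nxt (lab n q x) (x.1 n) := fun _ _ _ => rfl
  have hconn : ∀ n (x : O), Relation.ReflTransGen (Adj (dual δ)) (ξ n) (x.1 n) := by
    rintro n ⟨_, l, rfl⟩
    induction l with
    | nil => exact .refl
    | cons q l ih => exact ih.tail ((hAdj _ _).2 (.inl ⟨_, rfl⟩))
  have hlift : ∀ n k V, Sync (lab n) act V → ∃ W, Sync (lab (n + k)) act W ∧ V ⊆ W := by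
    intro n k V hV
    induction k with
    | zero => exact ⟨V, hV, subset_rfl⟩
    | succ k ih =>
      obtain ⟨W, hW, hVW⟩ := ih
      obtain ⟨U, hU, hWU⟩ := hW.exists_superset hout (hf (n + k)) (hlab' (n + k))
      exact ⟨U, hU, hVW.trans hWU⟩
  have hgrow : ∀ k : ℕ, ∃ n V, Sync (lab n) act V ∧ k < V.card := by
    intro k
    induction k with
    | zero => exact ⟨0, {⟨ξ, [], rfl⟩}, .single _, by simp⟩
    | succ k ih =>
      obtain ⟨n, V, hV, hk⟩ := ih
      obtain ⟨n', hn' : ξ n' = a, hlt⟩ := ha.exists_gt n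
      obtain ⟨j, rfl⟩ := Nat.exists_eq_add_of_le hlt.le
      obtain ⟨W, hW, hVW⟩ := hlift n j V hV
      have hcard := Finset.card_le_card hVW
      have hc' : ∀ x : O, Relation.ReflTransGen
          (fun a b => (∃ q, out q a = b) ∨ ∃ q, out q b = a) (x.1 (n + j)) c := by
        intro x
        rw [← hRel]
        refine (hsymm (hconn (n + j) x)).trans ?_
        rw [hn']
        exact (hsymm haP).trans hc
      obtain ⟨U, hU, hUc⟩ := exists_sync_two_mul_le hout (hf (n + j)) (hlab' (n + j))
        (fun x => omegaState_injective hnxt x.1 (n + j)) hact hc' ha₁₂ h₁.1 h₂.1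
        (h₁.2.trans h₂.2.symm) hW (Finset.card_pos.1 (by omega))
      exact ⟨_, U, hU, by omega⟩
  obtain ⟨n, V, -, hV⟩ := hgrow (Fintype.card O)
  exact absurd (Finset.card_le_univ V) (by omega)

end AutOrbit
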